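/- Let N ≥ 1 be an integer and set a = 2√π/√N. Then for every integer n with |n·a| + a/2 ≤ aN/2 (i.e., |n| ≤ (N−1)/2), the function f_{a,N} attains a local maximum at some point in the open interval (n·a − a/2, n·a + a/2). Consequently, f_{a,N} (and hence the Gaussian mixture density (2N+1)^{−1}·f_{a,N}, whose centres all lie in [−2√(πN), 2√(πN)]) has at least N − 1 distinct local maximum points inside [−√(πN), √(πN)]. -/

import Mathlib

/-- The standard Gaussian density on ℝ: φ(t) = (1/√(2π))·e^{−t²/2}. -/
noncomputable def stdGaussian (t : ℝ) : ℝ :=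
  (1 / Real.sqrt (2 * Real.pi)) * Real.exp (-t ^ 2 / 2)

/-- The truncated mixture f_{a,N}(x) = Σ_{n=−N}^{N} φ(x − a·n). -/
noncomputable def truncGaussianMix (a : ℝ) (N : ℕ) (x : ℝ) : ℝ :=
  ∑ n ∈ Finset.Icc (-(N : ℤ)) (N : ℤ), stdGaussian (x - a * n)

noncomputable def gmE (A y : ℝ) : ℝ := Real.exp (-Real.pi * A * y ^ 2)

noncomputable def gmT (A : ℝ) : ℝ := ∑' m : ℤ, gmE A m

lemma gmE_pos (A y : ℝ) : 0 < gmE A y := Real.exp_pos _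

lemma gm_hasSum {A : ℝ} (hA : 0 < A) : HasSum (fun m : ℤ => gmE A m) (gmT A) := by
  refine Summable.hasSum ?_
  have := summable_pow_mul_jacobiTheta₂_term_bound 0 hA 0
  refine this.congr (fun m => ?_)
  simp [gmE]
  ring_nf

lemma gm_hasSum_shift {A : ℝ} (hA : 0 < A) (n : ℤ) :
    HasSum (fun m : ℤ => gmE A ((n : ℝ) - m)) (gmT A) := by
  have := (Equiv.subLeft n).hasSum_iff.2 (gm_hasSum hA)
  simpa [Function.comp_def] using this

lemma gm_hasSum_half {A : ℝ} (hA : 0 < A) (n : ℤ) :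
    HasSum (fun m : ℤ => gmE A ((n : ℝ) + 1 / 2 - m)) (gmT (A / 4) - gmT A) := by
  have hA4 : 0 < A / 4 := by positivity
  have h := gm_hasSum hA4
  have i2 : Function.Injective (fun k : ℤ => 2 * k) := by intro x y; simp
  have i21 : Function.Injective (fun k : ℤ => 2 * k + 1) := by intro x y; simp
  have ho := (h.summable.comp_injective i21).hasSum
  have he : HasSum ((fun m : ℤ => gmE (A / 4) m) ∘ (fun k : ℤ => 2 * k)) (gmT A) := by
    refine (gm_hasSum hA).congr_fun ?_
    intro m
    simp only [Function.comp, gmE]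
    push_cast
    ring_nf
  have r1 : Set.range (fun k : ℤ => 2 * k) = {n : ℤ | Even n} := by
    ext x
    simp only [Set.mem_range, Set.mem_ofPred_eq, even_iff_exists_two_mul, eq_comm]
  have r2 : Set.range (fun k : ℤ => 2 * k + 1) = {n : ℤ | Odd n} := by
    ext x
    simp only [Set.mem_range, Set.mem_ofPred_eq, Odd, eq_comm]
  have hc : IsCompl (Set.range (fun k : ℤ => 2 * k)) (Set.range (fun k : ℤ => 2 * k + 1)) := by
    rw [r1, r2]
    exact Int.isCompl_even_odd
  have hs := HasSum.add_isCompl (f := fun m : ℤ => gmE (A / 4) m) hc (i2.hasSum_range_iff.2 he) (i21.hasSum_range_iff.2 ho)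
  have heq := hs.unique h
  have hoo : (∑' k : ℤ, ((fun m : ℤ => gmE (A / 4) m) ∘ (fun k : ℤ => 2 * k + 1)) k)
      = gmT (A / 4) - gmT A := by linarith
  rw [hoo] at ho
  have := (Equiv.subLeft n).hasSum_iff.2 ho
  refine this.congr_fun (fun m => ?_)
  simp only [Function.comp, gmE, Equiv.subLeft_apply]
  push_cast
  ring_nf

lemma gmT_func {A : ℝ} (hA : 0 < A) : gmT A = 1 / Real.sqrt A * gmT (1 / A) := by
  have := Real.tsum_exp_neg_mul_int_sq hA
  rw [← Real.sqrt_eq_rpow] at this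
  simp only [gmT, gmE]
  rw [this]
  congr 2
  ext m
  congr 1
  ring

lemma gm_gap {A : ℝ} (hA : 0 < A) :
    gmT A - (gmT (A / 4) - gmT A) = 1 / Real.sqrt A * (2 * (gmT (1 / A) - gmT (4 * (1 / A)))) := by
  rw [gmT_func hA, gmT_func (show 0 < A / 4 by positivity)]
  have h1 : Real.sqrt (A / 4) = Real.sqrt A / 2 := by
    rw [Real.sqrt_div hA.le, show (4 : ℝ) = 2 ^ 2 by norm_num, Real.sqrt_sq (by norm_num)]
  have h2 : 1 / (A / 4) = 4 * (1 / A) := by field_simp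
  have : Real.sqrt A ≠ 0 := (Real.sqrt_pos.2 hA).ne'
  rw [h1, h2]
  field_simp
  ring

lemma gm_gap_lower {B : ℝ} (hB : 0 < B) :
    2 * (gmE B 1 - gmE (4 * B) 1) ≤ gmT B - gmT (4 * B) := by
  have h := (gm_hasSum hB).sub (gm_hasSum (show 0 < 4 * B by positivity))
  have := sum_le_hasSum ({1, -1} : Finset ℤ) (fun m _ => ?_) h
  · rw [Finset.sum_pair (by norm_num)] at this
    simp only [gmE] at this ⊢
    norm_num at this ⊢
    linarith
  · simp only [gmE, sub_nonneg]
    apply Real.exp_le_exp.2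
    have : 0 ≤ Real.pi * B * (m : ℝ) ^ 2 := by positivity
    nlinarith

lemma gm_exp_half : Real.exp (-(Real.pi / 2)) ≤ 1 / 2 := by
  have h := Real.add_one_le_exp (Real.pi / 2)
  rw [Real.exp_neg, inv_le_comm₀ (Real.exp_pos _) (by norm_num)]
  linarith [Real.pi_gt_three]

lemma gmT_le {B : ℝ} (hB : 1 / 2 ≤ B) : gmT B ≤ 3 := by
  have hB0 : 0 < B := by linarith
  have h := norm_jacobiTheta_sub_one_le (τ := Complex.I * B) (by simpa using hB0)
  have e : jacobiTheta (Complex.I * B) = ((gmT B : ℝ) : ℂ) := by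
    simp only [jacobiTheta, gmT, gmE]
    rw [Complex.ofReal_tsum]
    congr 1
    ext m
    push_cast
    congr 1
    linear_combination (Real.pi * (m : ℂ) ^ 2 * B) * Complex.I_mul_I
  rw [e, ← Complex.ofReal_one, ← Complex.ofReal_sub, Complex.norm_real] at h
  have him : (Complex.I * (B : ℂ)).im = B := by simp
  rw [him] at h
  have hr : Real.exp (-Real.pi * B) ≤ 1 / 2 := by
    refine le_trans (Real.exp_le_exp.2 ?_) gm_exp_half
    nlinarith [Real.pi_pos]
  have h2 : 2 / (1 - Real.exp (-Real.pi * B)) * Real.exp (-Real.pi * B) ≤ 2 := by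
    rw [div_mul_eq_mul_div, div_le_iff₀ (by linarith)]
    linarith
  have := (le_abs_self _).trans (h.trans h2)
  linarith

/-- Truncation error. -/
lemma gm_trunc {A : ℝ} (hA : 0 < A) (N : ℕ) (n : ℤ) (h1 : -(N : ℤ) ≤ n) (h2 : n ≤ N) :
    gmT A ≤ ∑ m ∈ Finset.Icc (-(N : ℤ)) N, gmE A ((n : ℝ) - m) +
      (gmE A (N + 1 - n) * gmT A + gmE A (N + 1 + n) * gmT A) := by
  have hs := hasSum_sum_of_ne_finset_zero (L := SummationFilter.unconditional ℤ) (f := fun m : ℤ => if m ∈ Finset.Icc (-(N : ℤ)) N then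
      gmE A ((n : ℝ) - m) else 0) (s := Finset.Icc (-(N : ℤ)) N) (fun m hm => if_neg hm)
  have e : ∑ m ∈ Finset.Icc (-(N : ℤ)) N, (if m ∈ Finset.Icc (-(N : ℤ)) N then
      gmE A ((n : ℝ) - m) else 0) = ∑ m ∈ Finset.Icc (-(N : ℤ)) N, gmE A ((n : ℝ) - m) :=
    Finset.sum_congr rfl (fun m hm => if_pos hm)
  rw [e] at hs
  have ha := (gm_hasSum_shift hA (N + 1)).mul_left (gmE A (N + 1 - n))
  have hb := (gm_hasSum_shift hA (-(N + 1))).mul_left (gmE A (N + 1 + n))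
  refine hasSum_le (fun m => ?_) (gm_hasSum_shift hA n) (hs.add (ha.add hb))
  have pa := mul_pos (gmE_pos A (N + 1 - n)) (gmE_pos A (((N + 1 : ℤ) : ℝ) - m))
  have pb := mul_pos (gmE_pos A (N + 1 + n)) (gmE_pos A (((-(N + 1) : ℤ) : ℝ) - m))
  have h1' : -(N : ℝ) ≤ n := by exact_mod_cast h1
  have h2' : (n : ℝ) ≤ N := by exact_mod_cast h2
  have hpA : 0 < Real.pi * A := by positivity
  by_cases hm : m ∈ Finset.Icc (-(N : ℤ)) N
  · rw [if_pos hm]; linarith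
  · rw [if_neg hm]
    rw [Finset.mem_Icc, not_and_or, not_le, not_le] at hm
    rcases hm with hm | hm
    · have hm' : (m : ℝ) + 1 ≤ -N := by exact_mod_cast hm
      have : gmE A ((n : ℝ) - m) ≤ gmE A (N + 1 + n) * gmE A (((-(N + 1) : ℤ) : ℝ) - m) := by
        simp only [gmE]
        rw [← Real.exp_add]
        apply Real.exp_le_exp.2
        push_cast
        have : 0 ≤ (Real.pi * A) * (((N : ℝ) + 1 + n) * (-(N + 1) - m)) :=
          mul_nonneg hpA.le (mul_nonneg (by linarith) (by linarith))
        nlinarith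
      linarith
    · have hm' : (N : ℝ) + 1 ≤ m := by exact_mod_cast hm
      have : gmE A ((n : ℝ) - m) ≤ gmE A (N + 1 - n) * gmE A (((N + 1 : ℤ) : ℝ) - m) := by
        simp only [gmE]
        rw [← Real.exp_add]
        apply Real.exp_le_exp.2
        push_cast
        have : 0 ≤ (Real.pi * A) * (((N : ℝ) + 1 - n) * (m - (N + 1))) :=
          mul_nonneg hpA.le (mul_nonneg (by linarith) (by linarith))
        nlinarith
      linarith

lemma gm_E_bound {N : ℕ} (hN : 1 ≤ N) {k : ℝ} (hk : ((N : ℝ) + 3) / 2 ≤ k) :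
    gmE (2 / N) k ≤ gmE (N / 2) 1 * (1 / 8) := by
  have hN' : (1 : ℝ) ≤ N := by exact_mod_cast hN
  have h8 : Real.exp (-(3 * Real.pi)) ≤ 1 / 8 := by
    have h := Real.add_one_le_exp (3 * Real.pi)
    rw [Real.exp_neg, inv_le_comm₀ (Real.exp_pos _) (by norm_num)]
    linarith [Real.pi_gt_three]
  refine le_trans ?_ (mul_le_mul_of_nonneg_left h8 (gmE_pos _ _).le)
  simp only [gmE]
  rw [← Real.exp_add]
  apply Real.exp_le_exp.2
  have hk2 : (((N : ℝ) + 3) / 2) ^ 2 ≤ k ^ 2 := by gcongr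
  have : (N : ℝ) / 2 + 3 ≤ 2 / N * k ^ 2 := by
    rw [div_mul_eq_mul_div, le_div_iff₀ (by linarith)]
    nlinarith
  nlinarith [mul_le_mul_of_nonneg_left this Real.pi_pos.le]

/-- Main comparison. -/
lemma gm_main {N : ℕ} (hN : 1 ≤ N) (n n' : ℤ) (h1 : 2 * n + 1 ≤ N) (h2 : -2 * n + 1 ≤ N) :
    ∑ m ∈ Finset.Icc (-(N : ℤ)) N, gmE (2 / N) ((n' : ℝ) + 1 / 2 - m) <
    ∑ m ∈ Finset.Icc (-(N : ℤ)) N, gmE (2 / N) ((n : ℝ) - m) := by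
  have hN' : (1 : ℝ) ≤ N := by exact_mod_cast hN
  have hA : (0 : ℝ) < 2 / N := by positivity
  have h1' : 2 * (n : ℝ) + 1 ≤ N := by exact_mod_cast h1
  have h2' : -2 * (n : ℝ) + 1 ≤ N := by exact_mod_cast h2
  have hup := sum_le_hasSum (Finset.Icc (-(N : ℤ)) N) (fun m _ => (gmE_pos _ _).le)
    (gm_hasSum_half hA n')
  have hlow := gm_trunc hA N n (by omega) (by omega)
  have hgap := gm_gap hA
  have hinv : (1 : ℝ) / (2 / N) = N / 2 := by field_simp
  have hf := gmT_func hA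
  rw [hinv] at hgap hf
  have hB : (1 : ℝ) / 2 ≤ N / 2 := by linarith
  have hg := gm_gap_lower (show (0 : ℝ) < N / 2 by positivity)
  have hT3 := gmT_le hB
  have b1 := gm_E_bound hN (k := N + 1 - n) (by linarith)
  have b2 := gm_E_bound hN (k := N + 1 + n) (by linarith)
  have hs : 0 < 1 / Real.sqrt (2 / N) := by positivity
  set s := 1 / Real.sqrt (2 / (N : ℝ))
  have hT0 : 0 < gmT (2 / N) := by
    rw [gmT]
    exact (gm_hasSum hA).summable.tsum_pos (fun m => (gmE_pos _ _).le) 0 (gmE_pos _ _)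
  set q := gmE (N / 2) 1
  have hq : 0 < q := gmE_pos _ _
  have hq2 : q ≤ 1 / 2 := by
    refine le_trans (Real.exp_le_exp.2 ?_) gm_exp_half
    nlinarith [Real.pi_pos]
  have hq4 : gmE (4 * (N / 2)) 1 = q ^ 4 := by
    simp only [q, gmE]
    rw [← Real.exp_nat_mul]
    congr 1
    push_cast
    ring
  rw [hq4] at hg
  have hq3 : q ^ 4 ≤ q * (1 / 8) := by
    have : q ^ 3 ≤ (1 / 2) ^ 3 := by gcongr
    nlinarith
  have c1 := mul_le_mul_of_nonneg_right b1 hT0.le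
  have c2 := mul_le_mul_of_nonneg_right b2 hT0.le
  have hTA : gmT (2 / N) ≤ s * 3 := by rw [hf]; gcongr
  have c3 : q * (1 / 8) * gmT (2 / N) ≤ q * (1 / 8) * (s * 3) := by gcongr
  have c4 : s * (2 * (2 * (q - q * (1 / 8)))) ≤
      s * (2 * (gmT (N / 2) - gmT (4 * (N / 2)))) := by
    gcongr; linarith
  have : 0 < s * q := by positivity
  nlinarith

lemma gm_eq {N : ℕ} (hN : 1 ≤ N) {a : ℝ}
    (ha : a = 2 * Real.sqrt Real.pi / Real.sqrt N) (y : ℝ) :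
    truncGaussianMix a N (y * a) = (1 / Real.sqrt (2 * Real.pi)) *
      ∑ m ∈ Finset.Icc (-(N : ℤ)) N, gmE (2 / N) (y - m) := by
  have hN' : (1 : ℝ) ≤ N := by exact_mod_cast hN
  have ha2 : a ^ 2 = 4 * Real.pi / N := by
    rw [ha, div_pow, mul_pow, Real.sq_sqrt Real.pi_pos.le, Real.sq_sqrt (by positivity)]
    norm_num
  unfold truncGaussianMix
  rw [Finset.mul_sum]
  refine Finset.sum_congr rfl (fun m _ => ?_)
  simp only [stdGaussian, gmE]
  congr 2
  have : -(y * a - a * m) ^ 2 / 2 = - a ^ 2 * (y - m) ^ 2 / 2 := by ring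
  rw [this, ha2]
  ring

lemma gm_continuous (a : ℝ) (N : ℕ) : Continuous (truncGaussianMix a N) := by
  unfold truncGaussianMix stdGaussian
  fun_prop

lemma gm_part1 (N : ℕ) (hN : 1 ≤ N) (a : ℝ)
    (ha : a = 2 * Real.sqrt Real.pi / Real.sqrt N) (n : ℤ)
    (h1 : 2 * n + 1 ≤ N) (h2 : -2 * n + 1 ≤ N) :
    ∃ x ∈ Set.Ioo ((n : ℝ) * a - a / 2) ((n : ℝ) * a + a / 2),
      IsLocalMax (truncGaussianMix a N) x := by
  have hN' : (1 : ℝ) ≤ N := by exact_mod_cast hN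
  have ha0 : 0 < a := by
    rw [ha]
    have := Real.pi_pos
    positivity
  have key : ∀ n' : ℤ, truncGaussianMix a N (((n' : ℝ) + 1 / 2) * a) <
      truncGaussianMix a N (n * a) := by
    intro n'
    rw [gm_eq hN ha, gm_eq hN ha]
    have := Real.pi_pos
    exact mul_lt_mul_of_pos_left (gm_main hN n n' h1 h2) (by positivity)
  refine isCompact_Icc.exists_isLocalMax_mem_open Set.Ioo_subset_Icc_self
    (gm_continuous a N).continuousOn (z := (n : ℝ) * a) ⟨by linarith, by linarith⟩ ?_ isOpen_Ioo
  rintro z ⟨hz, hz'⟩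
  have : z = (n : ℝ) * a - a / 2 ∨ z = (n : ℝ) * a + a / 2 := by
    by_contra! hne
    exact hz' ⟨lt_of_le_of_ne hz.1 hne.1.symm, lt_of_le_of_ne hz.2 hne.2⟩
  rcases this with rfl | rfl
  · have := key (n - 1)
    have e : (((n - 1 : ℤ) : ℝ) + 1 / 2) * a = (n : ℝ) * a - a / 2 := by push_cast; ring
    rwa [e] at this
  · have := key n
    have e : ((n : ℝ) + 1 / 2) * a = (n : ℝ) * a + a / 2 := by ring
    rwa [e] at this

/-- With a = 2√π/√N: for every integer n with |n·a| + a/2 ≤ aN/2, the function f_{a,N}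
has a local maximum in (n·a − a/2, n·a + a/2); consequently f_{a,N} — and hence the
Gaussian mixture density (2N+1)⁻¹·f_{a,N} — has at least N − 1 distinct local maximum
points inside [−√(πN), √(πN)]. -/
theorem truncGaussianMix_many_modes (N : ℕ) (hN : 1 ≤ N) (a : ℝ)
    (ha : a = 2 * Real.sqrt Real.pi / Real.sqrt N) :
    (∀ n : ℤ, |(n : ℝ) * a| + a / 2 ≤ a * N / 2 →
        ∃ x ∈ Set.Ioo ((n : ℝ) * a - a / 2) ((n : ℝ) * a + a / 2),
          IsLocalMax (truncGaussianMix a N) x) ∧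
      ∃ S : Finset ℝ,
        N - 1 ≤ S.card ∧
        (↑S : Set ℝ) ⊆
          Set.Icc (-Real.sqrt (Real.pi * N)) (Real.sqrt (Real.pi * N)) ∧
        ∀ x ∈ S,
          IsLocalMax (truncGaussianMix a N) x ∧
            IsLocalMax (fun y => (2 * (N : ℝ) + 1)⁻¹ * truncGaussianMix a N y) x := by
  have hN' : (1 : ℝ) ≤ N := by exact_mod_cast hN
  have ha0 : 0 < a := by
    rw [ha]
    have := Real.pi_pos
    positivity
  refine ⟨fun n hn => ?_, ?_⟩
  · rw [abs_mul, abs_of_pos ha0] at hn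
    have h3 : 2 * |(n : ℝ)| + 1 ≤ N := by
      by_contra! hc
      nlinarith
    have k1 : 2 * (n : ℝ) + 1 ≤ N := by linarith [le_abs_self (n : ℝ)]
    have k2 : -2 * (n : ℝ) + 1 ≤ N := by linarith [neg_le_abs (n : ℝ)]
    exact gm_part1 N hN a ha n (by exact_mod_cast k1) (by exact_mod_cast k2)
  · have hex : ∀ n : ℤ, ∃ x : ℝ, (2 * n + 1 ≤ N ∧ -2 * n + 1 ≤ N) →
        x ∈ Set.Ioo ((n : ℝ) * a - a / 2) ((n : ℝ) * a + a / 2) ∧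
          IsLocalMax (truncGaussianMix a N) x := by
      intro n
      by_cases h : 2 * n + 1 ≤ N ∧ -2 * n + 1 ≤ N
      · obtain ⟨x, hx⟩ := gm_part1 N hN a ha n h.1 h.2
        exact ⟨x, fun _ => hx⟩
      · exact ⟨0, fun h' => absurd h' h⟩
    choose g hg using hex
    have hI : ∀ n ∈ Finset.Icc (-(((N : ℤ) - 1) / 2)) (((N : ℤ) - 1) / 2),
        2 * n + 1 ≤ N ∧ -2 * n + 1 ≤ N := by
      intro n hn
      rw [Finset.mem_Icc] at hn
      omega
    refine ⟨(Finset.Icc (-(((N : ℤ) - 1) / 2)) (((N : ℤ) - 1) / 2)).image g, ?_, ?_, ?_⟩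
    · rw [Finset.card_image_of_injOn, Int.card_Icc]
      · omega
      · have hlt : ∀ x y : ℤ, (2 * x + 1 ≤ N ∧ -2 * x + 1 ≤ N) →
            (2 * y + 1 ≤ N ∧ -2 * y + 1 ≤ N) → x < y → g x < g y := by
          intro x y hx hy hxy
          have e1 := (hg x hx).1.2
          have e2 := (hg y hy).1.1
          have : (x : ℝ) + 1 ≤ y := by exact_mod_cast hxy
          nlinarith
        intro x hx y hy hxy
        rcases lt_trichotomy x y with h | h | h
        · exact absurd hxy (hlt x y (hI x hx) (hI y hy) h).ne
        · exact h
        · exact absurd hxy (hlt y x (hI y hy) (hI x hx) h).ne'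
    · intro x hx
      rw [Finset.mem_coe, Finset.mem_image] at hx
      obtain ⟨n, hn, rfl⟩ := hx
      have h := hI n hn
      have e := (hg n h).1
      have hr : Real.sqrt (Real.pi * N) = a * N / 2 := by
        rw [Real.sqrt_mul Real.pi_pos.le, ha]
        have hs : Real.sqrt N ≠ 0 := by positivity
        have := Real.mul_self_sqrt (show (0 : ℝ) ≤ N by positivity)
        field_simp
        linear_combination this
      have k1 : 2 * (n : ℝ) + 1 ≤ N := by exact_mod_cast h.1
      have k2 : -2 * (n : ℝ) + 1 ≤ N := by exact_mod_cast h.2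
      rw [hr]
      constructor
      · nlinarith [e.1]
      · nlinarith [e.2]
    · intro x hx
      rw [Finset.mem_image] at hx
      obtain ⟨n, hn, rfl⟩ := hx
      have h := (hg n (hI n hn)).2
      refine ⟨h, ?_⟩
      filter_upwards [h] with y hy
      exact mul_le_mul_of_nonneg_left hy (by positivity)
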